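/- arXiv:0910.1995 — 3 statements merged into one kernel-verified Lean document; each statement's English description precedes it below -/
import Mathlib

section
/- A ring R is von Neumann regular if and only if whenever A and B are submodules of an R-module E such that A and B are each f-injective R-modules, the intersection A ∩ B is an f-injective R-module. -/
/-- `M` is an f-injective `R`-module: every `R`-linear map from a finitely generated
ideal of `R` into `M` extends to an `R`-linear map `R → M`. -/
def FInjective (R M : Type*) [Ring R] [AddCommGroup M] [Module R M] : Prop :=
  ∀ I : Ideal R, I.FG →
    ∀ f : I →ₗ[R] M, ∃ g : R →ₗ[R] M, ∀ x : I, g (x : R) = f x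

universe u

lemma FInjective.of_equiv {R M N : Type*} [Ring R] [AddCommGroup M] [AddCommGroup N]
    [Module R M] [Module R N] (e : M ≃ₗ[R] N) (h : FInjective R M) : FInjective R N := by
  intro I hI f
  obtain ⟨g, hg⟩ := h I hI (e.symm.toLinearMap ∘ₗ f)
  exact ⟨e.toLinearMap ∘ₗ g, fun x => by simp [hg x]⟩

lemma Module.Baer.fInjective {R M : Type*} [Ring R] [AddCommGroup M] [Module R M]
    (h : Module.Baer R M) : FInjective R M := by
  intro I _ f
  obtain ⟨g, hg⟩ := h I f
  exact ⟨g, fun x => hg x x.2⟩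

/-- In a von Neumann regular ring every finitely generated left ideal has a right identity. -/
lemma exists_mem_right_identity_of_fg {R : Type*} [Ring R]
    (hR : ∀ a : R, ∃ x : R, a = a * x * a) (I : Ideal R) (hI : I.FG) :
    ∃ e ∈ I, ∀ x ∈ I, x * e = x := by
  induction I, hI using Submodule.fg_induction with
  | singleton a =>
    obtain ⟨x, hx⟩ := hR a
    refine ⟨x * a, Submodule.mem_span_singleton.2 ⟨x, rfl⟩, fun y hy => ?_⟩
    obtain ⟨r, rfl⟩ := Submodule.mem_span_singleton.1 hy
    rw [smul_eq_mul, mul_assoc, ← mul_assoc a, ← hx]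
  | sup I J _ _ ihI ihJ =>
    obtain ⟨e, heI, he⟩ := ihI
    obtain ⟨f, hfJ, hf⟩ := ihJ
    obtain ⟨y, hy⟩ := hR (f - f * e)
    set b := f - f * e with hb
    have hbmem : b ∈ I ⊔ J :=
      sub_mem (Submodule.mem_sup_right hfJ) (Submodule.mem_sup_left (I.smul_mem f heI))
    refine ⟨e + y * b - e * (y * b), ?_, fun z hz => ?_⟩
    · have hyb := (I ⊔ J).smul_mem y hbmem
      exact sub_mem (add_mem (Submodule.mem_sup_left heI) hyb) ((I ⊔ J).smul_mem e hyb)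
    · obtain ⟨x, hx, j, hj, rfl⟩ := Submodule.mem_sup.1 hz
      have hjb : j - j * e = j * b := by rw [hb, mul_sub, ← mul_assoc, hf j hj]
      have hj' : j * (e + y * b - e * (y * b)) = j := by
        calc j * (e + y * b - e * (y * b)) = j * e + (j - j * e) * (y * b) := by noncomm_ring
          _ = j * e + j * (b * y * b) := by rw [hjb]; noncomm_ring
          _ = j := by rw [← hy, ← hjb]; abel
      have hx' : x * (e + y * b - e * (y * b)) = x := by
        rw [mul_sub, mul_add, ← mul_assoc x e, he x hx]; abel
      rw [add_mul, hx', hj']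

lemma fInjective_of_vonNeumannRegular {R : Type*} [Ring R]
    (hR : ∀ a : R, ∃ x : R, a = a * x * a) (M : Type*) [AddCommGroup M] [Module R M] :
    FInjective R M := by
  intro I hI f
  obtain ⟨e, heI, he⟩ := exists_mem_right_identity_of_fg hR I hI
  refine ⟨LinearMap.toSpanSingleton R M (f ⟨e, heI⟩), fun x => ?_⟩
  rw [LinearMap.toSpanSingleton_apply, ← map_smul]
  exact congrArg f (Subtype.ext (he x x.2))

lemma exists_injective_linearMap_to_baer (R M : Type u) [Ring R] [AddCommGroup M]
    [Module R M] :
    ∃ (E : Type u) (_ : AddCommGroup E) (_ : Module R E) (i : M →ₗ[R] E),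
      Function.Injective i ∧ Module.Baer R E := by
  obtain ⟨⟨J, _, i, _⟩⟩ :=
    CategoryTheory.EnoughInjectives.presentation (ModuleCat.of R M)
  have : CategoryTheory.Injective (ModuleCat.of R J) := ‹CategoryTheory.Injective J›
  exact ⟨J, inferInstance, inferInstance, i.hom, (ModuleCat.mono_iff_injective i).1 ‹_›,
    Module.Baer.of_injective (Module.injective_module_of_injective_object R J)⟩

/-- If `M` embeds in `E`, then `M` is the intersection of two copies of `E` inside the
amalgamated sum of `E` with itself over `M`. -/
lemma exists_submodules_inter_equiv {R M E : Type*} [Ring R] [AddCommGroup M] [Module R M]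
    [AddCommGroup E] [Module R E] (i : M →ₗ[R] E) (hi : Function.Injective i) :
    ∃ (D : Submodule R (E × E)) (A B : Submodule R ((E × E) ⧸ D)),
      Nonempty (E ≃ₗ[R] A) ∧ Nonempty (E ≃ₗ[R] B) ∧ Nonempty (M ≃ₗ[R] ↥(A ⊓ B)) := by
  let D : Submodule R (E × E) := LinearMap.range (i.prod (-i))
  let α : E →ₗ[R] (E × E) ⧸ D := D.mkQ ∘ₗ LinearMap.inl R E E
  let β : E →ₗ[R] (E × E) ⧸ D := D.mkQ ∘ₗ LinearMap.inr R E E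
  have hαβ (x y : E) : α x = β y ↔ ∃ m, i m = x ∧ i m = y := by
    change D.mkQ (x, 0) = D.mkQ (0, y) ↔ _
    rw [Submodule.mkQ_apply, Submodule.mkQ_apply, Submodule.Quotient.eq, LinearMap.mem_range]
    simp
  have hα : Function.Injective α := by
    rw [injective_iff_map_eq_zero]
    intro x hx
    obtain ⟨m, rfl, hm⟩ := (hαβ x 0).1 (by rw [hx, map_zero])
    exact hm
  have hβ : Function.Injective β := by
    rw [injective_iff_map_eq_zero]
    intro y hy
    obtain ⟨m, hm, rfl⟩ := (hαβ 0 y).1 (by rw [hy, map_zero])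
    exact hm
  have hrange : LinearMap.range (α ∘ₗ i) = LinearMap.range α ⊓ LinearMap.range β := by
    ext q
    constructor
    · rintro ⟨m, rfl⟩
      exact ⟨⟨i m, rfl⟩, i m, ((hαβ _ _).2 ⟨m, rfl, rfl⟩).symm⟩
    · rintro ⟨⟨x, rfl⟩, y, hy⟩
      obtain ⟨m, rfl, _⟩ := (hαβ x y).1 hy.symm
      exact ⟨m, rfl⟩
  exact ⟨D, LinearMap.range α, LinearMap.range β, ⟨LinearEquiv.ofInjective α hα⟩,
    ⟨LinearEquiv.ofInjective β hβ⟩,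
    ⟨(LinearEquiv.ofInjective (α ∘ₗ i) (hα.comp hi)).trans (LinearEquiv.ofEq _ _ hrange)⟩⟩

lemma exists_eq_mul_mul_of_fInjective_span {R : Type*} [Ring R] (a : R)
    (h : FInjective R (Ideal.span {a})) : ∃ x : R, a = a * x * a := by
  obtain ⟨g, hg⟩ := h (Ideal.span {a}) (Submodule.fg_span_singleton a) LinearMap.id
  obtain ⟨x, hx⟩ := Ideal.mem_span_singleton'.1 (g 1).2
  refine ⟨x, ?_⟩
  have ha := congrArg Subtype.val (hg ⟨a, Ideal.mem_span_singleton_self a⟩)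
  have hsmul : g a = a • g 1 := by rw [← map_smul, smul_eq_mul, mul_one]
  rw [hsmul] at ha
  rw [mul_assoc, hx]
  exact ha.symm

/-- A ring `R` is von Neumann regular if and only if the intersection of any two
f-injective submodules of a module is f-injective. -/
theorem vonNeumannRegular_iff_inter_fInjective (R : Type u) [Ring R] :
    (∀ a : R, ∃ x : R, a = a * x * a) ↔
      ∀ (E : Type u) [AddCommGroup E] [Module R E] (A B : Submodule R E),
        FInjective R A → FInjective R B → FInjective R ↥(A ⊓ B) := by
  refine ⟨fun hR E _ _ A B _ _ => fInjective_of_vonNeumannRegular hR _, fun h a => ?_⟩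
  obtain ⟨E, _, _, i, hi, hE⟩ := exists_injective_linearMap_to_baer R (Ideal.span {a})
  obtain ⟨D, A, B, ⟨eA⟩, ⟨eB⟩, ⟨e⟩⟩ := exists_submodules_inter_equiv i hi
  exact exists_eq_mul_mul_of_fInjective_span a
    ((h _ A B (hE.fInjective.of_equiv eA) (hE.fInjective.of_equiv eB)).of_equiv e.symm)
end

section
/- For a Boolean ring R the following are equivalent: (1) for any two countably generated ideals I₁ and I₂ of R, Ann(I₁ ∩ I₂) = Ann(I₁) + Ann(I₂); (2) for any two countably generated ideals A and B of R with A ∩ B = (0), Ann(A) + Ann(B) = R; (3) R is ℵ₀-self-injective. -/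
/-- An ideal is countably generated. -/
def IdealCountablyGenerated {R : Type*} [Ring R] (I : Ideal R) : Prop :=
  ∃ s : Set R, s.Countable ∧ Ideal.span s = I

/-- `M` is an ℵ₀-injective `R`-module. -/
def Aleph0Injective (R M : Type*) [Ring R] [AddCommGroup M] [Module R M] : Prop :=
  ∀ I : Ideal R, IdealCountablyGenerated I →
    ∀ f : I →ₗ[R] M, ∃ g : R →ₗ[R] M, ∀ x : I, g (x : R) = f x

theorem IdealCountablyGenerated.sup {R : Type*} [Ring R] {I J : Ideal R}
    (hI : IdealCountablyGenerated I) (hJ : IdealCountablyGenerated J) :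
    IdealCountablyGenerated (I ⊔ J) := by
  obtain ⟨s, hs, rfl⟩ := hI
  obtain ⟨t, ht, rfl⟩ := hJ
  exact ⟨s ∪ t, hs.union ht, Ideal.span_union s t⟩

theorem IdealCountablyGenerated.singleton_mul {R : Type*} [CommRing R] {I : Ideal R}
    (hI : IdealCountablyGenerated I) (r : R) :
    IdealCountablyGenerated (Ideal.span {r} * I) := by
  obtain ⟨s, hs, hsI⟩ := hI
  refine ⟨(fun x => r * x) '' s, hs.image _, ?_⟩
  rw [← hsI, Ideal.span_mul_span', Set.singleton_mul]

theorem Ideal.mem_annihilator_iff_mul {R : Type*} [Ring R] {I : Ideal R} {r : R} :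
    r ∈ Module.annihilator R I ↔ ∀ x ∈ I, r * x = 0 := by
  simp [Module.mem_annihilator, Subtype.ext_iff]

namespace BooleanRing

variable {R : Type*} [BooleanRing R]

theorem annihilator_inf_eq_sup
    (h : ∀ A B : Ideal R, IdealCountablyGenerated A → IdealCountablyGenerated B →
      A ⊓ B = ⊥ → Module.annihilator R ↥A ⊔ Module.annihilator R ↥B = ⊤)
    {I J : Ideal R} (hI : IdealCountablyGenerated I) (hJ : IdealCountablyGenerated J) :
    Module.annihilator R ↥(I ⊓ J) = Module.annihilator R ↥I ⊔ Module.annihilator R ↥J := by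
  apply le_antisymm
  · intro r hr
    rw [Ideal.mem_annihilator_iff_mul] at hr
    have hdisj : Ideal.span {r} * I ⊓ Ideal.span {r} * J = ⊥ := by
      rw [eq_bot_iff]
      rintro x ⟨hx₁, hx₂⟩
      obtain ⟨y, hy, rfl⟩ := Ideal.mem_span_singleton_mul.1 hx₁
      have h0 := hr _ ⟨Ideal.mul_le_right hx₁, Ideal.mul_le_right hx₂⟩
      rwa [← mul_assoc, BooleanRing.mul_self] at h0
    have htop := h _ _ (hI.singleton_mul r) (hJ.singleton_mul r) hdisj
    obtain ⟨a, ha, b, hb, hab⟩ := Submodule.mem_sup.1 ((Ideal.eq_top_iff_one _).1 htop)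
    rw [Ideal.mem_annihilator_iff_mul] at ha hb
    refine Submodule.mem_sup.2 ⟨a * r, ?_, b * r, ?_, by rw [← add_mul, hab, one_mul]⟩
    · refine Ideal.mem_annihilator_iff_mul.2 fun x hx => ?_
      rw [mul_assoc]
      exact ha _ (Ideal.mul_mem_mul (Ideal.mem_span_singleton_self r) hx)
    · refine Ideal.mem_annihilator_iff_mul.2 fun x hx => ?_
      rw [mul_assoc]
      exact hb _ (Ideal.mul_mem_mul (Ideal.mem_span_singleton_self r) hx)
  · refine sup_le (fun r hr => ?_) fun r hr => ?_
    all_goals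
      rw [Ideal.mem_annihilator_iff_mul] at hr ⊢
    · exact fun x hx => hr x hx.1
    · exact fun x hx => hr x hx.2

theorem inf_eq_bot_of_mul_eq_bot {I J : Ideal R} (h : I * J = ⊥) : I ⊓ J = ⊥ := by
  rw [eq_bot_iff, ← h]
  rintro x ⟨hI, hJ⟩
  rw [← BooleanRing.mul_self x]
  exact Ideal.mul_mem_mul hI hJ

theorem map_mul_map {I : Ideal R} (f : I →ₗ[R] R) (x y : I) : f x * f y = y * f x := by
  have hx : x * f x = f x := by
    rw [← smul_eq_mul, ← map_smul]
    exact congrArg f (Subtype.ext (BooleanRing.mul_self (x : R)))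
  have hxy : x * f y = y * f x := by
    rw [← smul_eq_mul, ← smul_eq_mul, ← map_smul, ← map_smul]
    exact congrArg f (Subtype.ext (mul_comm (x : R) y))
  calc f x * f y = f x * (x * f y) := by rw [← mul_assoc, mul_comm (f x) (x : R), hx]
    _ = y * (f x * f x) := by rw [hxy]; ring
    _ = y * f x := by rw [BooleanRing.mul_self]

theorem aleph0Injective_of_annihilator_sup_eq_top
    (h : ∀ A B : Ideal R, IdealCountablyGenerated A → IdealCountablyGenerated B →
      A ⊓ B = ⊥ → Module.annihilator R ↥A ⊔ Module.annihilator R ↥B = ⊤) :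
    Aleph0Injective R R := by
  rintro I ⟨s, hs, rfl⟩ f
  have : Countable s := hs.to_subtype
  let e : s → Ideal.span s := fun x => ⟨x, Ideal.subset_span x.2⟩
  let A : Ideal R := Ideal.span (Set.range fun x => f (e x))
  let B : Ideal R := Ideal.span (Set.range fun x => (e x : R) - f (e x))
  have hAB : A * B = ⊥ := by
    rw [Ideal.span_mul_span', Ideal.span_eq_bot]
    rintro _ ⟨_, ⟨x, rfl⟩, _, ⟨y, rfl⟩, rfl⟩
    simp only [mul_sub, map_mul_map]
    rw [mul_comm, sub_self]
  have htop := h A B ⟨_, Set.countable_range _, rfl⟩ ⟨_, Set.countable_range _, rfl⟩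
    (inf_eq_bot_of_mul_eq_bot hAB)
  obtain ⟨a, ha, b, hb, hab⟩ := Submodule.mem_sup.1 ((Ideal.eq_top_iff_one _).1 htop)
  rw [Ideal.mem_annihilator_iff_mul] at ha hb
  refine ⟨LinearMap.mulLeft R b, fun x => ?_⟩
  have hgen (x : s) : b * x = f (e x) := by
    have h₁ : a * f (e x) = 0 := ha _ (Ideal.subset_span ⟨x, rfl⟩)
    have h₂ : b * (x - f (e x)) = 0 := hb _ (Ideal.subset_span ⟨x, rfl⟩)
    linear_combination h₂ - h₁ + f (e x) * hab
  obtain ⟨x, hx⟩ := x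
  induction hx using Submodule.span_induction with
  | mem x hx => exact hgen ⟨x, hx⟩
  | zero => exact (map_zero _).trans (map_zero f).symm
  | add x y hx hy ihx ihy =>
    exact (map_add _ x y).trans ((congrArg₂ _ ihx ihy).trans (map_add f ⟨x, hx⟩ ⟨y, hy⟩).symm)
  | smul r x hx ih =>
    exact (map_smul _ r x).trans ((congrArg _ ih).trans (map_smul f r ⟨x, hx⟩).symm)

end BooleanRing

theorem Aleph0Injective.annihilator_sup_eq_top {R : Type*} [CommRing R] (h : Aleph0Injective R R)
    {A B : Ideal R} (hA : IdealCountablyGenerated A) (hB : IdealCountablyGenerated B)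
    (hAB : A ⊓ B = ⊥) : Module.annihilator R ↥A ⊔ Module.annihilator R ↥B = ⊤ := by
  let p : R →ₗ.[R] R := ⟨A, A.subtype⟩
  let q : R →ₗ.[R] R := ⟨B, 0⟩
  have hpq (x : p.domain) (y : q.domain) (hxy : (x : R) = y) : p x = q y := by
    have hx : (x : R) ∈ A ⊓ B := ⟨x.2, hxy ▸ y.2⟩
    rwa [hAB] at hx
  obtain ⟨g, hg⟩ := h (A ⊔ B) (hA.sup hB) (p.sup q hpq).toFun
  have hgmul (x : R) : g x = g 1 * x := by
    rw [mul_comm, ← smul_eq_mul, ← map_smul, smul_eq_mul, mul_one]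
  have hgA (x : R) (hx : x ∈ A) : g x = x :=
    (hg ⟨x, Ideal.mem_sup_left hx⟩).trans ((LinearPMap.left_le_sup p q hpq).2
      (x := ⟨x, hx⟩) rfl).symm
  have hgB (x : R) (hx : x ∈ B) : g x = 0 :=
    (hg ⟨x, Ideal.mem_sup_right hx⟩).trans ((LinearPMap.right_le_sup p q hpq).2
      (x := ⟨x, hx⟩) rfl).symm
  refine (Ideal.eq_top_iff_one _).2
    (Submodule.mem_sup.2 ⟨1 - g 1, ?_, g 1, ?_, sub_add_cancel 1 (g 1)⟩)
  · refine Ideal.mem_annihilator_iff_mul.2 fun x hx => ?_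
    rw [sub_mul, one_mul, ← hgmul, hgA x hx, sub_self]
  · exact Ideal.mem_annihilator_iff_mul.2 fun x hx => (hgmul x).symm.trans (hgB x hx)

universe u

/-- For a Boolean ring `R` the following are equivalent:
(1) `Ann(I₁ ∩ I₂) = Ann(I₁) + Ann(I₂)` for all countably generated ideals `I₁, I₂`;
(2) `Ann(A) + Ann(B) = R` for all countably generated ideals `A, B` with `A ∩ B = (0)`;
(3) `R` is ℵ₀-self-injective. -/
theorem booleanRing_aleph0SelfInjective_tfae (R : Type u) [BooleanRing R] :
    List.TFAE
      [ ∀ I₁ I₂ : Ideal R, IdealCountablyGenerated I₁ → IdealCountablyGenerated I₂ →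
          Module.annihilator R ↥(I₁ ⊓ I₂) =
            Module.annihilator R ↥I₁ ⊔ Module.annihilator R ↥I₂,
        ∀ A B : Ideal R, IdealCountablyGenerated A → IdealCountablyGenerated B →
          A ⊓ B = ⊥ → Module.annihilator R ↥A ⊔ Module.annihilator R ↥B = ⊤,
        Aleph0Injective R R ] := by
  tfae_have 1 → 2 := fun h A B hA hB hAB => by
    rw [← h A B hA hB, hAB, Module.annihilator_eq_top_iff]
    infer_instance
  tfae_have 2 → 1 := fun h _ _ => BooleanRing.annihilator_inf_eq_sup h
  tfae_have 2 → 3 := BooleanRing.aleph0Injective_of_annihilator_sup_eq_top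
  tfae_have 3 → 2 := fun h _ _ => h.annihilator_sup_eq_top
  tfae_finish
end

section
/- Let R be a commutative ring. Then R is an ℵ₀-qc ring if and only if every factor ring R/I (for every ideal I of R) is an ℵ₀-self-injective ring. -/
/-- `M` is an ℵ₀-quasi-injective module over `S`. -/
def Aleph0QuasiInjective (S M : Type*) [Ring S] [AddCommGroup M] [Module S M] : Prop :=
  ∀ B : Submodule S M, (∃ s : Set M, s.Countable ∧ Submodule.span S s = B) →
    ∀ f : B →ₗ[S] M, ∃ g : M →ₗ[S] M, ∀ x : B, g (x : M) = f x

universe u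

/-- `S` is an ℵ₀-qc ring: every cyclic `S`-module is ℵ₀-quasi-injective. -/
def Aleph0QCRing (S : Type u) [Ring S] : Prop :=
  ∀ (N : Type u) [AddCommGroup N] [Module S N],
    (∃ x : N, Submodule.span S {x} = ⊤) → Aleph0QuasiInjective S N

/-- ℵ₀-quasi-injectivity is invariant under linear equivalence. -/
theorem Aleph0QuasiInjective.of_linearEquiv {S M N : Type*} [Ring S] [AddCommGroup M]
    [Module S M] [AddCommGroup N] [Module S N] (e : M ≃ₗ[S] N)
    (h : Aleph0QuasiInjective S M) : Aleph0QuasiInjective S N := by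
  rintro B ⟨s, hs, rfl⟩ f
  obtain ⟨g, hg⟩ := h ((Submodule.span S s).map (e.symm : N →ₗ[S] M))
    ⟨e.symm '' s, hs.image _, Submodule.span_image (e.symm : N →ₗ[S] M)⟩
    ((e.symm : N →ₗ[S] M) ∘ₗ f ∘ₗ
      ((e.symm.submoduleMap (Submodule.span S s)).symm : _ →ₗ[S] Submodule.span S s))
  refine ⟨(e : M →ₗ[S] N) ∘ₗ g ∘ₗ (e.symm : N →ₗ[S] M), fun x => ?_⟩
  have hx := hg (e.symm.submoduleMap (Submodule.span S s) x)
  simp only [LinearMap.comp_apply, LinearEquiv.coe_coe, LinearEquiv.symm_apply_apply,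
    LinearEquiv.submoduleMap_apply] at hx ⊢
  rw [hx, e.apply_symm_apply]

/-- For a surjective algebra map `R → A`, the ring `A` is ℵ₀-self-injective if and only if it is
ℵ₀-quasi-injective as an `R`-module. -/
theorem aleph0QuasiInjective_iff_aleph0Injective_of_surjective {R A : Type*} [CommRing R]
    [CommRing A] [Algebra R A] (hA : Function.Surjective (algebraMap R A)) :
    Aleph0QuasiInjective R A ↔ Aleph0Injective A A := by
  constructor
  · rintro h J ⟨s, hs, rfl⟩ f
    obtain ⟨g, hg⟩ := h ((Ideal.span s).restrictScalars R)
      ⟨s, hs, (Submodule.restrictScalars_span R A hA s).symm⟩ (f.restrictScalars R)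
    exact ⟨g.extendScalarsOfSurjective hA, hg⟩
  · rintro h B ⟨s, hs, rfl⟩
    rw [← Submodule.restrictScalars_span R A hA s]
    intro f
    obtain ⟨g, hg⟩ := h (Ideal.span s) ⟨s, hs, rfl⟩
      (LinearMap.extendScalarsOfSurjective hA (show Ideal.span s →ₗ[R] A from f))
    exact ⟨g.restrictScalars R, hg⟩

/-- A commutative ring `R` is an ℵ₀-qc ring iff every factor ring `R/I` is
ℵ₀-self-injective. -/
theorem aleph0QCRing_iff_quotients_aleph0SelfInjective (R : Type u) [CommRing R] :
    Aleph0QCRing R ↔ ∀ I : Ideal R, Aleph0Injective (R ⧸ I) (R ⧸ I) := by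
  have hsurj (I : Ideal R) : Function.Surjective (algebraMap R (R ⧸ I)) :=
    Ideal.Quotient.mk_surjective
  constructor
  · intro h I
    refine (aleph0QuasiInjective_iff_aleph0Injective_of_surjective (hsurj I)).mp (h (R ⧸ I) ⟨1, ?_⟩)
    refine eq_top_iff.mpr fun y _ => Submodule.mem_span_singleton.mpr ?_
    obtain ⟨r, rfl⟩ := hsurj I y
    exact ⟨r, (Algebra.algebraMap_eq_smul_one r).symm⟩
  · rintro h N _ _ ⟨x, hx⟩
    have hx' : Function.Surjective (LinearMap.toSpanSingleton R N x) := by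
      rw [← LinearMap.range_eq_top, LinearMap.range_toSpanSingleton, hx]
    exact .of_linearEquiv ((LinearMap.toSpanSingleton R N x).quotKerEquivOfSurjective hx')
      ((aleph0QuasiInjective_iff_aleph0Injective_of_surjective (hsurj _)).mpr (h _))
end
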